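/- Let b₁, b₂ be slowly varying functions, p₁, p₂, q₁, q₂ ∈ (0,∞], and whenever p_i = ∞ (i = 1,2) assume ‖ t^{−1/q_i} b_i(t) χ_{(0,1)}(t) ‖_{L^{q_i}(0,∞)} < ∞. If p₁ > p₂, then the embedding L^{p₁,q₁,b₁} ↪ L^{p₂,q₂,b₂} holds if and only if μ(R) < ∞. If p₁ < p₂, then the embedding L^{p₁,q₁,b₁} ↪ L^{p₂,q₂,b₂} never holds. -/

import Mathlib

open MeasureTheory Set Filter ENNReal Topology

noncomputable section

/-- `f ≈ g` on `S`: two-sided equivalence with positive constants. -/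
def EquivOn (f g : ℝ → ℝ) (S : Set ℝ) : Prop :=
  ∃ c C : ℝ, 0 < c ∧ 0 < C ∧ ∀ t ∈ S, c * g t ≤ f t ∧ f t ≤ C * g t

/-- A measurable positive function on `(0,∞)` is slowly varying if for every `ε > 0`,
`t ^ ε * b t` is equivalent to a non-decreasing function and `t ^ (-ε) * b t` is
equivalent to a non-increasing function on `(0,∞)`. -/
def IsSlowlyVarying (b : ℝ → ℝ) : Prop :=
  Measurable b ∧ (∀ t ∈ Set.Ioi (0:ℝ), 0 < b t) ∧
    ∀ ε : ℝ, 0 < ε →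
      (∃ bp : ℝ → ℝ, MonotoneOn bp (Set.Ioi 0) ∧
        EquivOn (fun t => t ^ ε * b t) bp (Set.Ioi 0)) ∧
      (∃ bm : ℝ → ℝ, AntitoneOn bm (Set.Ioi 0) ∧
        EquivOn (fun t => t ^ (-ε) * b t) bm (Set.Ioi 0))

/-- The non-increasing rearrangement `f*` (with values in `ℝ≥0∞`). -/
def rearr {X : Type*} [MeasurableSpace X] (μ : Measure X) (f : X → ℝ) (t : ℝ) : ℝ≥0∞ :=
  sInf {s : ℝ≥0∞ | μ {x | s < ENNReal.ofReal |f x|} ≤ ENNReal.ofReal t}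

/-- The maximal function `f**(t) = (1/t) ∫₀ᵗ f*`. -/
def maxf {X : Type*} [MeasurableSpace X] (μ : Measure X) (f : X → ℝ) (t : ℝ) : ℝ≥0∞ :=
  (ENNReal.ofReal t)⁻¹ * ∫⁻ s in Set.Ioo (0:ℝ) t, rearr μ f s

/-- The `L^q` "norm" over a subset `S ⊆ ℝ` of an `ℝ≥0∞`-valued function. -/
def lqNorm (q : ℝ≥0∞) (S : Set ℝ) (g : ℝ → ℝ≥0∞) : ℝ≥0∞ :=
  if q = ∞ then essSup g (volume.restrict S)
  else (∫⁻ t in S, g t ^ q.toReal) ^ (1 / q.toReal)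

/-- The Lorentz–Karamata functional `‖f‖_{p,q,b}`. -/
def lkNorm {X : Type*} [MeasurableSpace X] (μ : Measure X) (p q : ℝ≥0∞) (b : ℝ → ℝ)
    (f : X → ℝ) : ℝ≥0∞ :=
  lqNorm q (Set.Ioi 0)
    (fun t => ENNReal.ofReal (t ^ (p⁻¹.toReal - q⁻¹.toReal) * b t) * rearr μ f t)

/-- The Lorentz–Karamata functional `‖f‖_{(p,q,b)}` defined via the maximal function. -/
def lkMaxNorm {X : Type*} [MeasurableSpace X] (μ : Measure X) (p q : ℝ≥0∞) (b : ℝ → ℝ)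
    (f : X → ℝ) : ℝ≥0∞ :=
  lqNorm q (Set.Ioi 0)
    (fun t => ENNReal.ofReal (t ^ (p⁻¹.toReal - q⁻¹.toReal) * b t) * maxf μ f t)

/-- The `L^q(0,∞)` norm of `t ^ (1/p - 1/q) * b t` restricted to `S`. -/
def weightNorm (p q : ℝ≥0∞) (b : ℝ → ℝ) (S : Set ℝ) : ℝ≥0∞ :=
  lqNorm q S (fun t => ENNReal.ofReal (t ^ (p⁻¹.toReal - q⁻¹.toReal) * b t))

/-- A measure is non-atomic. -/
def IsNonatomic {X : Type*} [MeasurableSpace X] (μ : Measure X) : Prop :=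
  ∀ s : Set X, MeasurableSet s → 0 < μ s →
    ∃ t, t ⊆ s ∧ MeasurableSet t ∧ 0 < μ t ∧ μ t < μ s

/-- `b̃(t) = ∫₀ᵗ s⁻¹ b(s) ds`. -/
def svTilde (b : ℝ → ℝ) (t : ℝ) : ℝ≥0∞ :=
  ∫⁻ s in Set.Ioo (0:ℝ) t, ENNReal.ofReal (s⁻¹ * b s)

/-- `b̃_∞(t) = esssup_{s ∈ (0,t)} b(s)`. -/
def svTildeSup (b : ℝ → ℝ) (t : ℝ) : ℝ≥0∞ :=
  essSup (fun s => ENNReal.ofReal (b s)) (volume.restrict (Set.Ioo (0:ℝ) t))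

/-- `b̂(t) = ∫_t^∞ s⁻¹ b(s) ds`. -/
def svHat (b : ℝ → ℝ) (t : ℝ) : ℝ≥0∞ :=
  ∫⁻ s in Set.Ioi t, ENNReal.ofReal (s⁻¹ * b s)

/-- `b̂_∞(t) = esssup_{s ∈ (t,∞)} b(s)`. -/
def svHatSup (b : ℝ → ℝ) (t : ℝ) : ℝ≥0∞ :=
  essSup (fun s => ENNReal.ofReal (b s)) (volume.restrict (Set.Ioi t))

/-- The associate functional of a functional `N`. -/
def assocNorm {X : Type*} [MeasurableSpace X] (μ : Measure X) (N : (X → ℝ) → ℝ≥0∞)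
    (f : X → ℝ) : ℝ≥0∞ :=
  ⨆ (g : X → ℝ) (_ : Measurable g) (_ : N g ≤ 1), ∫⁻ x, ENNReal.ofReal |f x * g x| ∂μ

/-- The conjugate exponent: `q' = q/(q-1)` for `q ∈ (1,∞)`, `1' = ∞`, `∞' = 1`. -/
def conjE (q : ℝ≥0∞) : ℝ≥0∞ := (1 - q⁻¹)⁻¹

/-- The interval `(0, μ(R))` inside `ℝ`, where `μ(R)` may be infinite. -/
def IooMu {X : Type*} [MeasurableSpace X] (μ : Measure X) : Set ℝ :=
  {t : ℝ | 0 < t ∧ ENNReal.ofReal t < μ Set.univ}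

/-- The embedding `L^{p₁,q₁,b₁} ↪ L^{p₂,q₂,b₂}`. -/
def lkEmbed {X : Type*} [MeasurableSpace X] (μ : Measure X) (p1 q1 : ℝ≥0∞) (b1 : ℝ → ℝ)
    (p2 q2 : ℝ≥0∞) (b2 : ℝ → ℝ) : Prop :=
  ∃ C : ℝ≥0∞, C < ∞ ∧ ∀ f : X → ℝ, Measurable f →
    lkNorm μ p2 q2 b2 f ≤ C * lkNorm μ p1 q1 b1 f

/-- A rearrangement-invariant quasi-Banach function norm. -/
structure IsRIQuasiBFN {X : Type*} [MeasurableSpace X] (μ : Measure X)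
    (N : (X → ℝ) → ℝ≥0∞) : Prop where
  abs_eq : ∀ f : X → ℝ, Measurable f → N (fun x => |f x|) = N f
  smul : ∀ (a : ℝ) (f : X → ℝ), Measurable f →
    N (fun x => a * f x) = ENNReal.ofReal |a| * N f
  eq_zero_iff : ∀ f : X → ℝ, Measurable f → (N f = 0 ↔ f =ᵐ[μ] 0)
  quasi_add : ∃ C : ℝ≥0∞, C < ∞ ∧ ∀ f g : X → ℝ, Measurable f → Measurable g →
    N (fun x => f x + g x) ≤ C * (N f + N g)
  mono : ∀ f g : X → ℝ, Measurable f → Measurable g →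
    (∀ᵐ x ∂μ, |f x| ≤ |g x|) → N f ≤ N g
  fatou : ∀ (f : ℕ → X → ℝ) (g : X → ℝ), (∀ n, Measurable (f n)) → Measurable g →
    (∀ᵐ x ∂μ, ∀ n, 0 ≤ f n x) → (∀ᵐ x ∂μ, Monotone fun n => f n x) →
    (∀ᵐ x ∂μ, Filter.Tendsto (fun n => f n x) Filter.atTop (nhds (g x))) →
    N g = ⨆ n, N (f n)
  ind_lt_top : ∀ E : Set X, MeasurableSet E → μ E < ∞ →
    N (Set.indicator E fun _ => (1:ℝ)) < ∞
  rearr_inv : ∀ f g : X → ℝ, Measurable f → Measurable g →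
    rearr μ f = rearr μ g → N f = N g

/-- A rearrangement-invariant Banach function norm. -/
structure IsRIBFN {X : Type*} [MeasurableSpace X] (μ : Measure X)
    (N : (X → ℝ) → ℝ≥0∞) : Prop where
  abs_eq : ∀ f : X → ℝ, Measurable f → N (fun x => |f x|) = N f
  smul : ∀ (a : ℝ) (f : X → ℝ), Measurable f →
    N (fun x => a * f x) = ENNReal.ofReal |a| * N f
  eq_zero_iff : ∀ f : X → ℝ, Measurable f → (N f = 0 ↔ f =ᵐ[μ] 0)
  add_le : ∀ f g : X → ℝ, Measurable f → Measurable g →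
    N (fun x => f x + g x) ≤ N f + N g
  mono : ∀ f g : X → ℝ, Measurable f → Measurable g →
    (∀ᵐ x ∂μ, |f x| ≤ |g x|) → N f ≤ N g
  fatou : ∀ (f : ℕ → X → ℝ) (g : X → ℝ), (∀ n, Measurable (f n)) → Measurable g →
    (∀ᵐ x ∂μ, ∀ n, 0 ≤ f n x) → (∀ᵐ x ∂μ, Monotone fun n => f n x) →
    (∀ᵐ x ∂μ, Filter.Tendsto (fun n => f n x) Filter.atTop (nhds (g x))) →
    N g = ⨆ n, N (f n)
  ind_lt_top : ∀ E : Set X, MeasurableSet E → μ E < ∞ →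
    N (Set.indicator E fun _ => (1:ℝ)) < ∞
  integral_le : ∀ E : Set X, MeasurableSet E → μ E < ∞ →
    ∃ C : ℝ≥0∞, C < ∞ ∧ ∀ f : X → ℝ, Measurable f →
      ∫⁻ x in E, ENNReal.ofReal |f x| ∂μ ≤ C * N f
  rearr_inv : ∀ f g : X → ℝ, Measurable f → Measurable g →
    rearr μ f = rearr μ g → N f = N g

end

section lqNorm

variable {q : ℝ≥0∞} {S T : Set ℝ} {g h : ℝ → ℝ≥0∞}

theorem lqNorm_mono_set (hST : S ⊆ T) : lqNorm q S g ≤ lqNorm q T g := by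
  unfold lqNorm
  split_ifs
  · exact essSup_mono_measure (Measure.absolutelyContinuous_of_le (Measure.restrict_mono_set _ hST))
  · exact ENNReal.rpow_le_rpow (lintegral_mono_set hST) (by positivity)

theorem lqNorm_mono (hS : MeasurableSet S) (hgh : ∀ t ∈ S, g t ≤ h t) :
    lqNorm q S g ≤ lqNorm q S h := by
  unfold lqNorm
  split_ifs
  · exact essSup_mono_ae ((ae_restrict_iff' hS).2 (ae_of_all _ hgh))
  · refine ENNReal.rpow_le_rpow (setLIntegral_mono' hS fun t ht => ?_) (by positivity)
    exact ENNReal.rpow_le_rpow (hgh t ht) (by positivity)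

theorem const_mul_lqNorm_le (hq : 0 < q) (k : ℝ≥0∞) :
    k * lqNorm q S g ≤ lqNorm q S (fun t => k * g t) := by
  unfold lqNorm
  split_ifs with hqt
  · rw [ENNReal.essSup_const_mul]
  · have hq' : 0 < q.toReal := ENNReal.toReal_pos hq.ne' hqt
    calc k * (∫⁻ t in S, g t ^ q.toReal) ^ (1 / q.toReal)
        = (k ^ q.toReal * ∫⁻ t in S, g t ^ q.toReal) ^ (1 / q.toReal) := by
          rw [ENNReal.mul_rpow_of_nonneg _ _ (by positivity), ← ENNReal.rpow_mul,
            mul_one_div_cancel hq'.ne', ENNReal.rpow_one]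
      _ ≤ _ := by
          refine ENNReal.rpow_le_rpow ((lintegral_const_mul_le _ _).trans_eq ?_) (by positivity)
          simp only [ENNReal.mul_rpow_of_nonneg _ _ hq'.le]

theorem lqNorm_const_mul (hq : 0 < q) {k : ℝ≥0∞} (hk : k ≠ ∞) :
    lqNorm q S (fun t => k * g t) = k * lqNorm q S g := by
  refine le_antisymm ?_ (const_mul_lqNorm_le hq k)
  unfold lqNorm
  split_ifs with hqt
  · rw [ENNReal.essSup_const_mul]
  · have hq' : 0 < q.toReal := ENNReal.toReal_pos hq.ne' hqt
    simp only [ENNReal.mul_rpow_of_nonneg _ _ hq'.le]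
    rw [lintegral_const_mul' _ _ (ENNReal.rpow_ne_top_of_nonneg hq'.le hk),
      ENNReal.mul_rpow_of_nonneg _ _ (by positivity), ← ENNReal.rpow_mul,
      mul_one_div_cancel hq'.ne', ENNReal.rpow_one]

theorem lqNorm_le_of_eq_zero (hq : 0 < q) (hS : MeasurableSet S) (hT : MeasurableSet T)
    (hg : ∀ t ∈ T, t ∉ S → g t = 0) : lqNorm q T g ≤ lqNorm q S g := by
  unfold lqNorm
  split_ifs with hqt
  · refine essSup_le_of_ae_le _ ?_
    have h := (ae_restrict_iff' hS).1 (ENNReal.ae_le_essSup (μ := volume.restrict S) g)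
    refine (ae_restrict_iff' hT).2 ?_
    filter_upwards [h] with t ht htT
    by_cases htS : t ∈ S
    · exact ht htS
    · simp [hg t htT htS]
  · have hq' : 0 < q.toReal := ENNReal.toReal_pos hq.ne' hqt
    refine ENNReal.rpow_le_rpow ?_ (by positivity)
    rw [← lintegral_indicator hS]
    calc ∫⁻ t in T, g t ^ q.toReal
        ≤ ∫⁻ t in T, S.indicator (fun t => g t ^ q.toReal) t := by
          refine setLIntegral_mono' hT fun t ht => ?_
          by_cases htS : t ∈ S
          · simp [htS]
          · simp [hg t ht htS, hq']
      _ ≤ _ := setLIntegral_le_lintegral _ _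

theorem exists_lqNorm_union_le (q : ℝ≥0∞) : ∃ K : ℝ≥0∞, K < ∞ ∧
    ∀ (S T : Set ℝ) (g : ℝ → ℝ≥0∞),
      lqNorm q (S ∪ T) g ≤ K * (lqNorm q S g + lqNorm q T g) := by
  by_cases hqt : q = ∞
  · refine ⟨1, one_lt_top, fun S T g => ?_⟩
    simp only [lqNorm, hqt, if_true, one_mul]
    refine essSup_le_of_ae_le _ ?_
    refine ae_restrict_union_iff _ _ _ |>.2 ⟨?_, ?_⟩
    · filter_upwards [ENNReal.ae_le_essSup (μ := volume.restrict S) g] with t ht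
      exact ht.trans le_self_add
    · filter_upwards [ENNReal.ae_le_essSup (μ := volume.restrict T) g] with t ht
      exact ht.trans le_add_self
  · refine ⟨2 ^ (1 / q.toReal), ENNReal.rpow_lt_top_of_nonneg (by positivity) (by simp),
      fun S T g => ?_⟩
    simp only [lqNorm, hqt, if_false]
    set x := ∫⁻ t in S, g t ^ q.toReal
    set y := ∫⁻ t in T, g t ^ q.toReal
    have h0 : 0 ≤ 1 / q.toReal := by positivity
    calc _ ≤ (2 * max x y) ^ (1 / q.toReal) := by
          refine ENNReal.rpow_le_rpow ((lintegral_union_le _ _ _).trans ?_) h0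
          rw [two_mul]
          exact add_le_add (le_max_left _ _) (le_max_right _ _)
      _ = 2 ^ (1 / q.toReal) * (max x y) ^ (1 / q.toReal) :=
          ENNReal.mul_rpow_of_nonneg _ _ h0
      _ ≤ _ := by
          gcongr
          rcases max_cases x y with h | h <;> rw [h.1]
          · exact le_self_add
          · exact le_add_self

theorem exists_lqNorm_rpow_le (hq : 0 < q) {a : ℝ} (ha : 0 < a) : ∃ C : ℝ, 0 < C ∧ ∀ t : ℝ, 0 < t →
    lqNorm q (Ioo 0 t) (fun s => ENNReal.ofReal (s ^ (a - q⁻¹.toReal))) ≤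
      ENNReal.ofReal (C * t ^ a) := by
  by_cases hqt : q = ∞
  · refine ⟨1, one_pos, fun t ht => ?_⟩
    simp only [lqNorm, hqt, if_true, one_mul]
    refine essSup_le_of_ae_le _ ((ae_restrict_iff' measurableSet_Ioo).2 (ae_of_all _ ?_))
    intro s hs
    simp only [inv_top, toReal_zero, sub_zero]
    exact ENNReal.ofReal_le_ofReal (Real.rpow_le_rpow hs.1.le hs.2.le ha.le)
  · have hq' : 0 < q.toReal := ENNReal.toReal_pos hq.ne' hqt
    refine ⟨(1 / (a * q.toReal)) ^ (1 / q.toReal), by positivity, fun t ht => ?_⟩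
    simp only [lqNorm, hqt, if_false]
    have hint : ∫⁻ s in Ioo 0 t, ENNReal.ofReal (s ^ (a - q⁻¹.toReal)) ^ q.toReal
        = ENNReal.ofReal (t ^ (a * q.toReal) / (a * q.toReal)) := by
      have h1 : ∀ s ∈ Ioo 0 t, ENNReal.ofReal (s ^ (a - q⁻¹.toReal)) ^ q.toReal
          = ENNReal.ofReal (s ^ (a * q.toReal - 1)) := by
        intro s hs
        rw [ENNReal.ofReal_rpow_of_nonneg (Real.rpow_nonneg hs.1.le _) hq'.le,
          ← Real.rpow_mul hs.1.le, ENNReal.toReal_inv, sub_mul, inv_mul_cancel₀ hq'.ne']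
      have hpos : 0 < a * q.toReal := by positivity
      rw [setLIntegral_congr_fun measurableSet_Ioo h1, restrict_Ioo_eq_restrict_Ioc,
        ← ofReal_integral_eq_lintegral_ofReal, ← intervalIntegral.integral_of_le ht.le,
        integral_rpow (Or.inl (by linarith))]
      · simp [Real.zero_rpow hpos.ne']
      · exact (intervalIntegrable_iff_integrableOn_Ioc_of_le ht.le).1
          (intervalIntegral.intervalIntegrable_rpow' (by linarith))
      · refine (ae_restrict_iff' measurableSet_Ioc).2 (ae_of_all _ fun s hs => ?_)
        exact Real.rpow_nonneg hs.1.le _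
    rw [hint, ENNReal.ofReal_rpow_of_nonneg (by positivity) (by positivity)]
    refine ENNReal.ofReal_le_ofReal (le_of_eq ?_)
    rw [div_eq_mul_one_div, Real.mul_rpow (by positivity) (by positivity), ← Real.rpow_mul ht.le,
      mul_assoc, mul_one_div_cancel hq'.ne', mul_one, mul_comm]

theorem exists_le_lqNorm_rpow (hq : 0 < q) (a : ℝ) : ∃ c : ℝ, 0 < c ∧ ∀ t : ℝ, 0 < t →
    ENNReal.ofReal (c * t ^ a) ≤
      lqNorm q (Ioo (t / 2) t) (fun s => ENNReal.ofReal (s ^ (a - q⁻¹.toReal))) := by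
  set r : ℝ := a - q⁻¹.toReal with hr
  have key : ∀ t : ℝ, 0 < t → ∀ s ∈ Ioo (t / 2) t, min 1 (2⁻¹ ^ r) * t ^ r ≤ s ^ r := by
    intro t ht s hs
    have hs0 : 0 < s := (half_pos ht).trans hs.1
    rcases le_total 0 r with h | h
    · calc _ ≤ 2⁻¹ ^ r * t ^ r := by gcongr; exact min_le_right _ _
        _ = (t / 2) ^ r := by
          rw [← Real.mul_rpow (by norm_num) ht.le]; congr 1; ring
        _ ≤ _ := Real.rpow_le_rpow (half_pos ht).le hs.1.le h
    · calc _ ≤ 1 * t ^ r := by gcongr; exact min_le_left _ _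
        _ ≤ s ^ r := by
          rw [one_mul]
          exact Real.rpow_le_rpow_of_nonpos hs0 hs.2.le h
  have hd : (0 : ℝ) < min 1 (2⁻¹ ^ r) := by positivity
  set d : ℝ := min 1 (2⁻¹ ^ r)
  by_cases hqt : q = ∞
  · refine ⟨d, hd, fun t ht => ?_⟩
    refine le_trans ?_ (lqNorm_mono (g := fun _ => ENNReal.ofReal (d * t ^ r)) measurableSet_Ioo
      fun s hs => ENNReal.ofReal_le_ofReal (key t ht s hs))
    simp only [lqNorm, hqt, if_true]
    rw [essSup_const]
    · simp [hr, hqt]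
    · rw [Ne, Measure.restrict_eq_zero, Real.volume_Ioo, ENNReal.ofReal_eq_zero]
      linarith
  · have hq' : 0 < q.toReal := ENNReal.toReal_pos hq.ne' hqt
    refine ⟨d * 2⁻¹ ^ (1 / q.toReal), by positivity, fun t ht => ?_⟩
    refine le_trans ?_ (lqNorm_mono (g := fun _ => ENNReal.ofReal (d * t ^ r)) measurableSet_Ioo
      fun s hs => ENNReal.ofReal_le_ofReal (key t ht s hs))
    simp only [lqNorm, hqt, if_false]
    rw [setLIntegral_const, Real.volume_Ioo, ENNReal.mul_rpow_of_nonneg _ _ (by positivity),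
      ← ENNReal.rpow_mul, mul_one_div_cancel hq'.ne', ENNReal.rpow_one,
      ENNReal.ofReal_rpow_of_nonneg (by linarith) (by positivity),
      ← ENNReal.ofReal_mul (by positivity)]
    refine ENNReal.ofReal_le_ofReal (le_of_eq ?_)
    rw [show t - t / 2 = 2⁻¹ * t by ring, Real.mul_rpow (by norm_num) ht.le, mul_mul_mul_comm,
      ← Real.rpow_add ht, hr, ENNReal.toReal_inv]
    congr 2
    ring

end lqNorm

namespace IsSlowlyVarying

variable {b : ℝ → ℝ}

theorem exists_rpow_mul_le (hb : IsSlowlyVarying b) {δ : ℝ} (hδ : 0 < δ) :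
    ∃ K : ℝ, 0 < K ∧ ∀ t u : ℝ, 0 < t → t ≤ u → t ^ δ * b t ≤ K * (u ^ δ * b u) := by
  obtain ⟨g, hg, c, C, hc, hC, h⟩ := (hb.2.2 δ hδ).1
  refine ⟨C / c, by positivity, fun t u ht htu => ?_⟩
  have hu := ht.trans_le htu
  calc _ ≤ C * g t := (h t ht).2
    _ ≤ C * g u := mul_le_mul_of_nonneg_left (hg ht hu htu) hC.le
    _ = C / c * (c * g u) := by field_simp
    _ ≤ _ := mul_le_mul_of_nonneg_left (h u hu).1 (by positivity)

theorem exists_rpow_neg_mul_le (hb : IsSlowlyVarying b) {δ : ℝ} (hδ : 0 < δ) :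
    ∃ K : ℝ, 0 < K ∧ ∀ t u : ℝ, 0 < t → t ≤ u → u ^ (-δ) * b u ≤ K * (t ^ (-δ) * b t) := by
  obtain ⟨g, hg, c, C, hc, hC, h⟩ := (hb.2.2 δ hδ).2
  refine ⟨C / c, by positivity, fun t u ht htu => ?_⟩
  have hu := ht.trans_le htu
  calc _ ≤ C * g u := (h u hu).2
    _ ≤ C * g t := mul_le_mul_of_nonneg_left (hg ht hu htu) hC.le
    _ = C / c * (c * g t) := by field_simp
    _ ≤ _ := mul_le_mul_of_nonneg_left (h t ht).1 (by positivity)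

theorem exists_le_rpow_neg (hb : IsSlowlyVarying b) {δ M : ℝ} (hδ : 0 < δ) (hM : 0 < M) :
    ∃ C : ℝ, 0 < C ∧ ∀ t ∈ Ioc 0 M, b t ≤ C * t ^ (-δ) := by
  obtain ⟨K, hK, h⟩ := hb.exists_rpow_mul_le hδ
  have hbM := hb.2.1 M hM
  refine ⟨K * (M ^ δ * b M), by positivity, fun t ht => ?_⟩
  have hp := Real.rpow_pos_of_pos ht.1 δ
  rw [Real.rpow_neg ht.1.le, ← div_eq_mul_inv, le_div_iff₀ hp, mul_comm]
  exact h t M ht.1 ht.2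

theorem exists_rpow_le (hb : IsSlowlyVarying b) {δ M : ℝ} (hδ : 0 < δ) (hM : 0 < M) :
    ∃ c : ℝ, 0 < c ∧ ∀ t ∈ Ioc 0 M, c * t ^ δ ≤ b t := by
  obtain ⟨K, hK, h⟩ := hb.exists_rpow_neg_mul_le hδ
  have hbM := hb.2.1 M hM
  refine ⟨M ^ (-δ) * b M / K, by positivity, fun t ht => ?_⟩
  have hp := Real.rpow_pos_of_pos ht.1 δ
  have := h t M ht.1 ht.2
  rw [Real.rpow_neg ht.1.le, ← div_eq_inv_mul] at this
  rw [div_mul_eq_mul_div, div_le_iff₀ hK]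
  calc _ ≤ K * (b t / t ^ δ) * t ^ δ := by gcongr
    _ = _ := by field_simp

theorem exists_le_rpow (hb : IsSlowlyVarying b) {δ M : ℝ} (hδ : 0 < δ) (hM : 0 < M) :
    ∃ C : ℝ, 0 < C ∧ ∀ t ∈ Ici M, b t ≤ C * t ^ δ := by
  obtain ⟨K, hK, h⟩ := hb.exists_rpow_neg_mul_le hδ
  have hbM := hb.2.1 M hM
  refine ⟨K * (M ^ (-δ) * b M), by positivity, fun t ht => ?_⟩
  have ht0 := hM.trans_le ht
  have hp := Real.rpow_pos_of_pos ht0 δ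
  have := h M t hM ht
  rwa [Real.rpow_neg ht0.le, ← div_eq_inv_mul, div_le_iff₀ hp] at this

theorem exists_rpow_neg_le (hb : IsSlowlyVarying b) {δ M : ℝ} (hδ : 0 < δ) (hM : 0 < M) :
    ∃ c : ℝ, 0 < c ∧ ∀ t ∈ Ici M, c * t ^ (-δ) ≤ b t := by
  obtain ⟨K, hK, h⟩ := hb.exists_rpow_mul_le hδ
  have hbM := hb.2.1 M hM
  refine ⟨M ^ δ * b M / K, by positivity, fun t ht => ?_⟩
  have ht0 := hM.trans_le ht
  have hp := Real.rpow_pos_of_pos ht0 δ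
  have := h M t hM ht
  rw [Real.rpow_neg ht0.le, ← div_eq_mul_inv, div_le_iff₀ hp, div_le_iff₀ hK]
  linarith

end IsSlowlyVarying

section weightNorm

variable {p q : ℝ≥0∞} {b : ℝ → ℝ} {S : Set ℝ}

theorem weightNorm_le_of_le_rpow (hq : 0 < q) (hS : MeasurableSet S) (hS0 : S ⊆ Ioi 0)
    {C e : ℝ} (hC : 0 < C) (h : ∀ t ∈ S, b t ≤ C * t ^ e) :
    weightNorm p q b S ≤ ENNReal.ofReal C *
      lqNorm q S (fun t => ENNReal.ofReal (t ^ (p⁻¹.toReal + e - q⁻¹.toReal))) := by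
  rw [← lqNorm_const_mul hq ofReal_ne_top]
  refine lqNorm_mono hS fun t ht => ?_
  have ht0 : 0 < t := hS0 ht
  rw [← ENNReal.ofReal_mul hC.le]
  refine ENNReal.ofReal_le_ofReal ?_
  calc _ ≤ t ^ (p⁻¹.toReal - q⁻¹.toReal) * (C * t ^ e) := by gcongr; exact h t ht
    _ = _ := by
      rw [mul_left_comm, ← Real.rpow_add ht0]
      congr 2
      ring

theorem le_weightNorm_of_rpow_le (hq : 0 < q) (hS : MeasurableSet S) (hS0 : S ⊆ Ioi 0)
    {c e : ℝ} (hc : 0 < c) (h : ∀ t ∈ S, c * t ^ e ≤ b t) :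
    ENNReal.ofReal c *
      lqNorm q S (fun t => ENNReal.ofReal (t ^ (p⁻¹.toReal + e - q⁻¹.toReal))) ≤
      weightNorm p q b S := by
  rw [← lqNorm_const_mul hq ofReal_ne_top]
  refine lqNorm_mono hS fun t ht => ?_
  have ht0 : 0 < t := hS0 ht
  rw [← ENNReal.ofReal_mul hc.le]
  refine ENNReal.ofReal_le_ofReal ?_
  calc _ = t ^ (p⁻¹.toReal - q⁻¹.toReal) * (c * t ^ e) := by
        rw [mul_left_comm, ← Real.rpow_add ht0]
        congr 2
        ring
    _ ≤ _ := by gcongr; exact h t ht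

theorem exists_weightNorm_Ioo_le (hq : 0 < q) (hb : IsSlowlyVarying b) {δ M : ℝ} (hδ : 0 < δ)
    (hδp : δ < p⁻¹.toReal) (hM : 0 < M) : ∃ C : ℝ, 0 < C ∧ ∀ t ∈ Ioc 0 M,
      weightNorm p q b (Ioo 0 t) ≤ ENNReal.ofReal (C * t ^ (p⁻¹.toReal - δ)) := by
  obtain ⟨C, hC, h⟩ := hb.exists_le_rpow_neg hδ hM
  obtain ⟨D, hD, hD'⟩ := exists_lqNorm_rpow_le hq (sub_pos.2 hδp)
  refine ⟨C * D, by positivity, fun t ht => ?_⟩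
  refine (weightNorm_le_of_le_rpow hq measurableSet_Ioo (fun s hs => hs.1) hC
    fun s hs => h s ⟨hs.1, hs.2.le.trans ht.2⟩).trans ?_
  rw [mul_assoc, ENNReal.ofReal_mul hC.le]
  gcongr
  exact hD' t ht.1

theorem exists_le_weightNorm_half (hq : 0 < q) (hb : IsSlowlyVarying b) {δ M : ℝ} (hδ : 0 < δ)
    (hM : 0 < M) : ∃ c : ℝ, 0 < c ∧ ∀ t ∈ Ioc 0 M,
      ENNReal.ofReal (c * t ^ (p⁻¹.toReal + δ)) ≤ weightNorm p q b (Ioo (t / 2) t) := by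
  obtain ⟨c, hc, h⟩ := hb.exists_rpow_le hδ hM
  obtain ⟨d, hd, hd'⟩ := exists_le_lqNorm_rpow hq (p⁻¹.toReal + δ)
  refine ⟨c * d, by positivity, fun t ht => ?_⟩
  have h0 : ∀ s ∈ Ioo (t / 2) t, 0 < s := fun s hs => (half_pos ht.1).trans hs.1
  refine le_trans ?_ (le_weightNorm_of_rpow_le hq measurableSet_Ioo h0 hc
    fun s hs => h s ⟨h0 s hs, hs.2.le.trans ht.2⟩)
  rw [mul_assoc, ENNReal.ofReal_mul hc.le]
  gcongr
  exact hd' t ht.1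

theorem exists_le_weightNorm_half_of_two_le (hq : 0 < q) (hb : IsSlowlyVarying b) {δ : ℝ}
    (hδ : 0 < δ) : ∃ c : ℝ, 0 < c ∧ ∀ t ∈ Ici (2 : ℝ),
      ENNReal.ofReal (c * t ^ (p⁻¹.toReal - δ)) ≤ weightNorm p q b (Ioo (t / 2) t) := by
  obtain ⟨c, hc, h⟩ := hb.exists_rpow_neg_le hδ one_pos
  obtain ⟨d, hd, hd'⟩ := exists_le_lqNorm_rpow hq (p⁻¹.toReal - δ)
  refine ⟨c * d, by positivity, fun t (ht : 2 ≤ t) => ?_⟩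
  have h1 : ∀ s ∈ Ioo (t / 2) t, 1 ≤ s := fun s hs => by linarith [hs.1]
  refine le_trans ?_ (le_weightNorm_of_rpow_le hq measurableSet_Ioo
    (fun s hs => one_pos.trans_le (h1 s hs)) hc fun s hs => h s (h1 s hs))
  rw [mul_assoc, ENNReal.ofReal_mul hc.le]
  gcongr
  exact hd' t (by linarith)

theorem exists_weightNorm_Ioo_le_of_one_le (hq : 0 < q) (hp : 0 < p) (hb : IsSlowlyVarying b)
    (hfin : p = ∞ → weightNorm ∞ q b (Ioo 0 1) < ∞) {δ : ℝ} (hδ : 0 < δ) :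
    ∃ C : ℝ, 0 < C ∧ ∀ t ∈ Ici (1 : ℝ),
      weightNorm p q b (Ioo 0 t) ≤ ENNReal.ofReal (C * t ^ (p⁻¹.toReal + δ)) := by
  have hA : weightNorm p q b (Ioo 0 1) < ∞ := by
    by_cases hpt : p = ∞
    · rw [hpt]; exact hfin hpt
    · have : 0 < p⁻¹.toReal := ENNReal.toReal_pos (by simpa using hpt) (by simpa using hp.ne')
      obtain ⟨C, -, h⟩ := exists_weightNorm_Ioo_le (p := p) hq hb (half_pos this)
        (half_lt_self this) one_pos
      exact (h 1 (by simp)).trans_lt ofReal_lt_top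
  obtain ⟨C, hC, h⟩ := hb.exists_le_rpow hδ one_pos
  obtain ⟨D, hD, hD'⟩ := exists_lqNorm_rpow_le hq (add_pos_of_nonneg_of_pos
    (ENNReal.toReal_nonneg (a := p⁻¹)) hδ)
  obtain ⟨K, hK, hK'⟩ := exists_lqNorm_union_le q
  set A := weightNorm p q b (Ioo 0 1)
  refine ⟨(K.toReal + 1) * (A.toReal + C * D), by positivity, fun t (ht : 1 ≤ t) => ?_⟩
  have ht0 : 0 < t := by linarith
  have hle : weightNorm p q b (Ioo 0 t) ≤ K * (A + weightNorm p q b (Ico 1 t)) := by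
    refine le_trans (lqNorm_mono_set fun s hs => ?_) (hK' _ _ _)
    rcases lt_or_ge s 1 with h | h
    · exact Or.inl ⟨hs.1, h⟩
    · exact Or.inr ⟨h, hs.2⟩
  have hB : weightNorm p q b (Ico 1 t) ≤ ENNReal.ofReal (C * D * t ^ (p⁻¹.toReal + δ)) := by
    refine (weightNorm_le_of_le_rpow hq measurableSet_Ico
      (fun s hs => one_pos.trans_le hs.1) hC fun s hs => h s hs.1).trans ?_
    rw [mul_assoc, ENNReal.ofReal_mul hC.le]
    gcongr
    exact (lqNorm_mono_set (Ico_subset_Ioo_left one_pos)).trans (hD' t ht0)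
  have hpow : 1 ≤ t ^ (p⁻¹.toReal + δ) := Real.one_le_rpow ht (by positivity)
  have hKle : K ≤ ENNReal.ofReal (K.toReal + 1) :=
    (ENNReal.le_ofReal_iff_toReal_le hK.ne (by positivity)).2 (by linarith)
  have hAle : A ≤ ENNReal.ofReal (A.toReal * t ^ (p⁻¹.toReal + δ)) :=
    (ENNReal.le_ofReal_iff_toReal_le hA.ne (by positivity)).2
      (le_mul_of_one_le_right (by positivity) hpow)
  refine hle.trans ?_
  rw [mul_assoc, ENNReal.ofReal_mul (by positivity), add_mul A.toReal,
    ENNReal.ofReal_add (p := A.toReal * _) (by positivity) (by positivity)]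
  exact mul_le_mul' hKle (add_le_add hAle hB)

end weightNorm

section rearr

variable {X : Type*} [MeasurableSpace X] {μ : Measure X}

theorem rearr_antitone (f : X → ℝ) : Antitone (rearr μ f) := fun _ _ h =>
  sInf_le_sInf fun _ hs => le_trans (α := ℝ≥0∞) hs (ENNReal.ofReal_le_ofReal h)

theorem rearr_eq_zero {f : X → ℝ} {t : ℝ} (h : μ {x | f x ≠ 0} ≤ ENNReal.ofReal t) :
    rearr μ f t = 0 := by
  refine le_antisymm (sInf_le ?_) zero_le
  simpa using h

theorem rearr_indicator_one {E : Set X} {t : ℝ} (h : ENNReal.ofReal t < μ E) :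
    rearr μ (E.indicator fun _ => (1 : ℝ)) t = 1 := by
  have hset : ∀ s : ℝ≥0∞, s < 1 →
      E ⊆ {x | s < ENNReal.ofReal |E.indicator (fun _ => (1 : ℝ)) x|} :=
    fun s hs x hx => by simpa [hx] using hs
  refine le_antisymm (sInf_le ?_) (le_sInf fun s hs => ?_)
  · refine (measure_mono_null (fun x hx => ?_) measure_empty).le.trans zero_le
    refine absurd (mem_ofPred_eq ▸ hx) (not_lt.2 (?_ : _ ≤ (1 : ℝ≥0∞)))
    by_cases hxE : x ∈ E <;> simp [hxE]
  · by_contra! hlt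
    exact absurd ((measure_mono (hset s hlt)).trans hs) h.not_ge

theorem lkNorm_indicator_one {p q : ℝ≥0∞} (hq : 0 < q) (b : ℝ → ℝ) {E : Set X}
    (hE : μ E ≠ ∞) : lkNorm μ p q b (E.indicator fun _ => (1 : ℝ)) =
      weightNorm p q b (Ioo 0 (μ E).toReal) := by
  have hone : ∀ t ∈ Ioo 0 (μ E).toReal, rearr μ (E.indicator fun _ => (1 : ℝ)) t = 1 :=
    fun t ht => rearr_indicator_one (by
      rw [ENNReal.ofReal_lt_iff_lt_toReal ht.1.le hE]; exact ht.2)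
  refine le_antisymm ?_ ?_
  · refine (lqNorm_le_of_eq_zero hq (measurableSet_Ioo (a := 0) (b := (μ E).toReal))
      measurableSet_Ioi fun t ht htn => ?_).trans
      (lqNorm_mono measurableSet_Ioo fun t ht => ?_)
    · have h : (μ E).toReal ≤ t := by
        by_contra! h
        exact htn ⟨ht, h⟩
      rw [rearr_eq_zero, mul_zero]
      refine (measure_mono fun x hx => ?_).trans ((ENNReal.le_ofReal_iff_toReal_le hE
        (le_of_lt ht)).2 h)
      by_contra hxE
      simp [hxE] at hx
    · rw [hone t ht, mul_one]
  · refine (lqNorm_mono measurableSet_Ioo fun t ht => ?_).trans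
      (lqNorm_mono_set (T := Ioi 0) fun t (ht : t ∈ Ioo 0 (μ E).toReal) => ht.1)
    rw [hone t ht, mul_one]

theorem rearr_mul_weightNorm_le {p q : ℝ≥0∞} (hq : 0 < q) (b : ℝ → ℝ) (f : X → ℝ) {t : ℝ}
    (ht : 0 < t) : rearr μ f t * weightNorm p q b (Ioo (t / 2) t) ≤ lkNorm μ p q b f := by
  refine (const_mul_lqNorm_le hq _).trans ((lqNorm_mono measurableSet_Ioo fun s hs => ?_).trans
    (lqNorm_mono_set (T := Ioi 0) fun s (hs : s ∈ Ioo (t / 2) t) => (half_pos ht).trans hs.1))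
  rw [mul_comm]
  gcongr
  exact rearr_antitone f hs.2.le

theorem IsNonatomic.exists_measure_toReal_lt [SigmaFinite μ] (hna : IsNonatomic μ)
    (hpos : 0 < μ univ) {ε : ℝ} (hε : 0 < ε) :
    ∃ E, MeasurableSet E ∧ μ E ≠ ∞ ∧ 0 < (μ E).toReal ∧ (μ E).toReal < ε := by
  obtain ⟨S, hS, hS0, hSt⟩ : ∃ S, MeasurableSet S ∧ 0 < μ S ∧ μ S < ∞ := by
    obtain ⟨n, hn⟩ : ∃ n, 0 < μ (spanningSets μ n) := by
      by_contra! h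
      refine hpos.ne' ?_
      rw [← iUnion_spanningSets μ, measure_iUnion_null_iff]
      exact fun n => le_antisymm (h n) zero_le
    exact ⟨_, measurableSet_spanningSets μ n, hn, measure_spanningSets_lt_top μ n⟩
  have key : ∀ n : ℕ, ∃ E, MeasurableSet E ∧ μ E ≠ ∞ ∧ 0 < (μ E).toReal ∧
      (μ E).toReal ≤ (μ S).toReal * (1 / 2) ^ n := by
    intro n
    induction n with
    | zero => exact ⟨S, hS, hSt.ne, ENNReal.toReal_pos hS0.ne' hSt.ne, by simp⟩
    | succ n ih =>
      obtain ⟨E, hE, hEt, hE0, hEle⟩ := ih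
      obtain ⟨F, hFE, hF, hF0, hFlt⟩ := hna E hE (ENNReal.toReal_pos_iff.1 hE0).1
      have hFt : μ F ≠ ∞ := (hFlt.trans hEt.lt_top).ne
      have hdt : μ (E \ F) ≠ ∞ := ((measure_mono sdiff_subset).trans_lt hEt.lt_top).ne
      have hsum : (μ F).toReal + (μ (E \ F)).toReal = (μ E).toReal := by
        rw [← ENNReal.toReal_add hFt hdt, ← measure_inter_add_sdiff E hF,
          inter_eq_self_of_subset_right hFE]
      have hFlt' := (ENNReal.toReal_lt_toReal hFt hEt).2 hFlt
      rw [pow_succ]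
      rcases le_total (μ F).toReal (μ (E \ F)).toReal with h | h
      · exact ⟨F, hF, hFt, ENNReal.toReal_pos hF0.ne' hFt, by linarith⟩
      · exact ⟨E \ F, hE.diff hF, hdt, by linarith, by linarith⟩
  have hS' := ENNReal.toReal_pos hS0.ne' hSt.ne
  obtain ⟨n, hn⟩ := exists_pow_lt_of_lt_one (div_pos hε hS') (by norm_num : (1 / 2 : ℝ) < 1)
  obtain ⟨E, hE, hEt, hE0, hEle⟩ := key n
  refine ⟨E, hE, hEt, hE0, hEle.trans_lt ?_⟩
  rwa [lt_div_iff₀' hS'] at hn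

theorem exists_lt_measure_toReal [SigmaFinite μ] (hμ : μ univ = ∞) {M : ℝ} (hM : 0 ≤ M) :
    ∃ E, MeasurableSet E ∧ μ E ≠ ∞ ∧ M < (μ E).toReal := by
  obtain ⟨E, hE, -, hlt, hfin⟩ :=
    Measure.exists_subset_measure_lt_top (μ := μ) (r := ENNReal.ofReal M) MeasurableSet.univ
      (by simp [hμ])
  exact ⟨E, hE, hfin.ne, (ENNReal.ofReal_lt_iff_lt_toReal hM hfin.ne).1 hlt⟩

end rearr

section embedding

variable {X : Type*} [MeasurableSpace X] {μ : Measure X} {p1 p2 q1 q2 : ℝ≥0∞} {b1 b2 : ℝ → ℝ}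

theorem lkEmbed.exists_weightNorm_le (hq1 : 0 < q1) (hq2 : 0 < q2)
    (h : lkEmbed μ p1 q1 b1 p2 q2 b2) : ∃ C : ℝ, 0 < C ∧ ∀ E, MeasurableSet E → μ E ≠ ∞ →
      weightNorm p2 q2 b2 (Ioo 0 (μ E).toReal) ≤
        ENNReal.ofReal C * weightNorm p1 q1 b1 (Ioo 0 (μ E).toReal) := by
  obtain ⟨C, hC, h⟩ := h
  refine ⟨C.toReal + 1, by positivity, fun E hE hEt => ?_⟩
  have := h _ (measurable_const.indicator hE : Measurable (E.indicator fun _ => (1 : ℝ)))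
  rw [lkNorm_indicator_one hq2 _ hEt, lkNorm_indicator_one hq1 _ hEt] at this
  refine this.trans ?_
  gcongr
  rw [ENNReal.le_ofReal_iff_toReal_le hC.ne (by positivity)]
  linarith

theorem not_lkEmbed_of_inv_lt [SigmaFinite μ] (hna : IsNonatomic μ) (hpos : 0 < μ univ)
    (hq1 : 0 < q1) (hq2 : 0 < q2) (hb1 : IsSlowlyVarying b1) (hb2 : IsSlowlyVarying b2)
    (hp : p2⁻¹.toReal < p1⁻¹.toReal) : ¬ lkEmbed μ p1 q1 b1 p2 q2 b2 := by
  intro h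
  obtain ⟨A, hA, hemb⟩ := h.exists_weightNorm_le hq1 hq2
  set x1 := p1⁻¹.toReal
  set x2 := p2⁻¹.toReal
  have hx2' : 0 ≤ x2 := ENNReal.toReal_nonneg
  set δ := (x1 - x2) / 3 with hδdef
  have hδ : 0 < δ := by linarith
  obtain ⟨C, hC, hup⟩ := exists_weightNorm_Ioo_le (p := p1) hq1 hb1 hδ
    (by linarith) one_pos
  obtain ⟨c, hc, hlow⟩ := exists_le_weightNorm_half (p := p2) hq2 hb2 hδ one_pos
  have hlim : Tendsto (fun t : ℝ => t ^ δ) (𝓝 0) (𝓝 0) := by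
    simpa [Real.zero_rpow hδ.ne'] using (Real.continuousAt_rpow_const 0 δ (Or.inr hδ.le)).tendsto
  obtain ⟨ε, hε, hball⟩ := Metric.eventually_nhds_iff.1
    (hlim.eventually (gt_mem_nhds (show 0 < c / (A * C) by positivity)))
  obtain ⟨E, hE, hEt, hE0, hElt⟩ := hna.exists_measure_toReal_lt hpos (lt_min hε one_pos)
  have hemb := hemb E hE hEt
  set t := (μ E).toReal
  have ht1 : t ∈ Ioc 0 1 := ⟨hE0, (hElt.trans_le (min_le_right _ _)).le⟩
  have hsmall := hball (y := t) (by
    rw [Real.dist_eq, sub_zero, abs_of_pos hE0]; exact hElt.trans_le (min_le_left _ _))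
  have hchain : ENNReal.ofReal (c * t ^ (x2 + δ)) ≤
      ENNReal.ofReal (A * (C * t ^ (x1 - δ))) := by
    rw [ENNReal.ofReal_mul hA.le]
    refine ((hlow t ht1).trans ((lqNorm_mono_set ?_).trans hemb)).trans ?_
    · exact Ioo_subset_Ioo_left (by linarith)
    · gcongr
      exact hup t ht1
  rw [ENNReal.ofReal_le_ofReal_iff (by positivity),
    show x1 - δ = (x2 + δ) + δ by rw [hδdef]; ring, Real.rpow_add hE0 (x2 + δ)] at hchain
  have hpow : 0 < t ^ (x2 + δ) := by positivity
  rw [lt_div_iff₀ (by positivity)] at hsmall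
  nlinarith

theorem not_lkEmbed_of_measure_univ_eq_top [SigmaFinite μ] (hμ : μ univ = ∞) (hp1 : 0 < p1)
    (hq1 : 0 < q1) (hq2 : 0 < q2) (hb1 : IsSlowlyVarying b1) (hb2 : IsSlowlyVarying b2)
    (h1 : p1 = ∞ → weightNorm ∞ q1 b1 (Ioo 0 1) < ∞)
    (hp : p1⁻¹.toReal < p2⁻¹.toReal) : ¬ lkEmbed μ p1 q1 b1 p2 q2 b2 := by
  intro h
  obtain ⟨A, hA, hemb⟩ := h.exists_weightNorm_le hq1 hq2
  set x1 := p1⁻¹.toReal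
  set x2 := p2⁻¹.toReal
  set δ := (x2 - x1) / 3 with hδdef
  have hδ : 0 < δ := by linarith
  obtain ⟨C, hC, hup⟩ := exists_weightNorm_Ioo_le_of_one_le hq1 hp1 hb1 h1 hδ
  obtain ⟨c, hc, hlow⟩ := exists_le_weightNorm_half_of_two_le (p := p2) hq2 hb2 hδ
  obtain ⟨M, hM⟩ := eventually_atTop.1
    ((tendsto_rpow_atTop hδ).eventually (eventually_gt_atTop (A * C / c)))
  obtain ⟨E, hE, hEt, hlt⟩ := exists_lt_measure_toReal hμ (M := max M 2)
    (le_max_of_le_right zero_le_two)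
  have hemb := hemb E hE hEt
  set t := (μ E).toReal
  have ht2 : 2 ≤ t := (le_max_right _ _).trans hlt.le
  have ht0 : 0 < t := by linarith
  have hlarge := hM t ((le_max_left _ _).trans hlt.le)
  have hchain : ENNReal.ofReal (c * t ^ (x2 - δ)) ≤
      ENNReal.ofReal (A * (C * t ^ (x1 + δ))) := by
    rw [ENNReal.ofReal_mul hA.le]
    refine ((hlow t ht2).trans ((lqNorm_mono_set ?_).trans hemb)).trans ?_
    · exact Ioo_subset_Ioo_left (by linarith)
    · gcongr
      exact hup t (show 1 ≤ t by linarith)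
  rw [ENNReal.ofReal_le_ofReal_iff (by positivity),
    show x2 - δ = (x1 + δ) + δ by rw [hδdef]; ring, Real.rpow_add ht0 (x1 + δ)] at hchain
  have hpow : 0 < t ^ (x1 + δ) := by positivity
  rw [div_lt_iff₀ hc] at hlarge
  nlinarith

theorem lkEmbed_of_measure_univ_lt_top (hpos : 0 < μ univ) (hμ : μ univ < ∞) (hq1 : 0 < q1)
    (hq2 : 0 < q2) (hb1 : IsSlowlyVarying b1) (hb2 : IsSlowlyVarying b2)
    (hp : p1⁻¹.toReal < p2⁻¹.toReal) : lkEmbed μ p1 q1 b1 p2 q2 b2 := by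
  set x1 := p1⁻¹.toReal
  set x2 := p2⁻¹.toReal
  set δ := (x2 - x1) / 3 with hδdef
  have hδ : 0 < δ := by linarith
  set m := (μ univ).toReal
  have hm : 0 < m := ENNReal.toReal_pos hpos.ne' hμ.ne
  obtain ⟨c, hc, hlow⟩ := exists_le_weightNorm_half (p := p1) hq1 hb1 hδ hm
  obtain ⟨C, hC, hbup⟩ := hb2.exists_le_rpow_neg hδ hm
  obtain ⟨D, hD, hDup⟩ := exists_lqNorm_rpow_le hq2 hδ
  refine ⟨ENNReal.ofReal (C / c) * ENNReal.ofReal (D * m ^ δ),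
    ENNReal.mul_lt_top ofReal_lt_top ofReal_lt_top, fun f _ => ?_⟩
  set N := lkNorm μ p1 q1 b1 f
  by_cases hNt : N = ∞
  · rw [hNt, ENNReal.mul_top (by positivity)]
    exact le_top
  have hpt : ∀ t ∈ Ioo 0 m,
      ENNReal.ofReal (t ^ (x2 - q2⁻¹.toReal) * b2 t) * rearr μ f t ≤
        ENNReal.ofReal (C / c) * N * ENNReal.ofReal (t ^ (δ - q2⁻¹.toReal)) := by
    intro t ht
    have ht' : t ∈ Ioc 0 m := ⟨ht.1, ht.2.le⟩
    have ht0 : 0 < t := ht.1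
    have h1 : rearr μ f t * ENNReal.ofReal (c * t ^ (x1 + δ)) ≤ N :=
      le_trans (mul_le_mul_right (hlow t ht') _) (rearr_mul_weightNorm_le hq1 b1 f ht0)
    have hw : t ^ (x2 - q2⁻¹.toReal) * b2 t ≤
        C / c * t ^ (δ - q2⁻¹.toReal) * (c * t ^ (x1 + δ)) := by
      calc _ ≤ t ^ (x2 - q2⁻¹.toReal) * (C * t ^ (-δ)) := by gcongr; exact hbup t ht'
        _ = C * t ^ ((δ - q2⁻¹.toReal) + (x1 + δ)) := by
          rw [mul_left_comm, ← Real.rpow_add ht0]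
          congr 2
          rw [hδdef]; ring
        _ = _ := by rw [Real.rpow_add ht0]; field_simp
    calc _ ≤ ENNReal.ofReal (C / c * t ^ (δ - q2⁻¹.toReal) * (c * t ^ (x1 + δ))) *
          rearr μ f t := mul_le_mul_left (ENNReal.ofReal_le_ofReal hw) _
      _ = ENNReal.ofReal (C / c) * (rearr μ f t * ENNReal.ofReal (c * t ^ (x1 + δ))) *
          ENNReal.ofReal (t ^ (δ - q2⁻¹.toReal)) := by
          rw [ENNReal.ofReal_mul (by positivity), ENNReal.ofReal_mul (by positivity)]
          ring
      _ ≤ _ := by gcongr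
  calc lkNorm μ p2 q2 b2 f
      ≤ lqNorm q2 (Ioo 0 m) _ := lqNorm_le_of_eq_zero hq2 measurableSet_Ioo measurableSet_Ioi
        fun t ht htn => by
          have h : m ≤ t := by
            by_contra! h
            exact htn ⟨ht, h⟩
          rw [rearr_eq_zero, mul_zero]
          exact (measure_mono (subset_univ _)).trans
            ((ENNReal.le_ofReal_iff_toReal_le hμ.ne (le_of_lt ht)).2 h)
    _ ≤ _ := lqNorm_mono measurableSet_Ioo hpt
    _ = ENNReal.ofReal (C / c) * N *
        lqNorm q2 (Ioo 0 m) (fun t => ENNReal.ofReal (t ^ (δ - q2⁻¹.toReal))) :=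
        lqNorm_const_mul hq2 (ENNReal.mul_ne_top ofReal_ne_top hNt)
    _ ≤ ENNReal.ofReal (C / c) * N * ENNReal.ofReal (D * m ^ δ) := by
        gcongr
        exact hDup m hm
    _ = _ := by ring

end embedding

/-- Theorem TELK, cases 1 and 4: if `p₁ > p₂` then the embedding holds
iff `μ(R) < ∞`; if `p₁ < p₂` the embedding never holds. -/
theorem lk_embedding_different_p {X : Type*} [MeasurableSpace X] (μ : Measure X)
    [SigmaFinite μ] (hna : IsNonatomic μ) (hpos : 0 < μ Set.univ)
    (p1 p2 q1 q2 : ℝ≥0∞) (hp1 : 0 < p1) (hp2 : 0 < p2) (hq1 : 0 < q1) (hq2 : 0 < q2)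
    (b1 b2 : ℝ → ℝ) (hb1 : IsSlowlyVarying b1) (hb2 : IsSlowlyVarying b2)
    (h1 : p1 = ∞ → weightNorm ∞ q1 b1 (Set.Ioo 0 1) < ∞)
    (h2 : p2 = ∞ → weightNorm ∞ q2 b2 (Set.Ioo 0 1) < ∞) :
    (p2 < p1 → (lkEmbed μ p1 q1 b1 p2 q2 b2 ↔ μ Set.univ < ∞)) ∧
    (p1 < p2 → ¬ lkEmbed μ p1 q1 b1 p2 q2 b2) := by
  have hinv : ∀ p p' : ℝ≥0∞, 0 < p → p < p' → p'⁻¹.toReal < p⁻¹.toReal := fun p p' h0 h =>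
    ENNReal.toReal_strict_mono (ENNReal.inv_ne_top.2 h0.ne') (ENNReal.inv_lt_inv.2 h)
  refine ⟨fun h => ⟨fun hemb => ?_, fun hμ => ?_⟩, fun h => ?_⟩
  · by_contra hμ
    exact not_lkEmbed_of_measure_univ_eq_top (not_lt_top_iff.1 hμ) hp1 hq1 hq2 hb1 hb2 h1
      (hinv p2 p1 hp2 h) hemb
  · exact lkEmbed_of_measure_univ_lt_top hpos hμ hq1 hq2 hb1 hb2 (hinv p2 p1 hp2 h)
  · exact not_lkEmbed_of_inv_lt hna hpos hq1 hq2 hb1 hb2 (hinv p1 p2 hp1 h)
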